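/- arXiv:2112.06156 — 2 statements merged into one kernel-verified Lean document; each statement's English description precedes it below -/
import Mathlib

section
/- Let f be a complex-valued arithmetic function and let η ∈ (0,2) be fixed. Assume there is a constant C > 0 such that ∑_{n ≤ x} |f(n)|² ≤ C x^η for all real x ≥ 1. Then ∑_{x^{1/3} < n ≤ x} f(⌊x/n⌋) = C_f · x + O(x^{(1+η)/3}) as x → ∞, where C_f = ∑_{n=1}^∞ f(n)/(n(n+1)). -/
open Finset Filter Asymptotics

/-- A mean-square bound gives a mean bound by the Cauchy-Schwarz inequality. -/
theorem sum_norm_le_of_sum_sq_le (f : ℕ → ℂ) {η C : ℝ} (hC : 0 ≤ C) {x : ℝ} (hx : 1 ≤ x)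
    (hf : ∑ n ∈ Finset.Icc 1 ⌊x⌋₊, ‖f n‖ ^ 2 ≤ C * x ^ η) :
    ∑ n ∈ Finset.Icc 1 ⌊x⌋₊, ‖f n‖ ≤ √C * x ^ ((1 + η) / 2) := by
  have hx0 : 0 < x := by linarith
  refine (pow_le_pow_iff_left₀ (by positivity) (by positivity) two_ne_zero).1 ?_
  calc (∑ n ∈ Finset.Icc 1 ⌊x⌋₊, ‖f n‖) ^ 2
      ≤ (Finset.Icc 1 ⌊x⌋₊).card * ∑ n ∈ Finset.Icc 1 ⌊x⌋₊, ‖f n‖ ^ 2 :=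
        sq_sum_le_card_mul_sum_sq
    _ ≤ x * (C * x ^ η) := by
        gcongr
        simpa using Nat.floor_le hx0.le
    _ = (√C * x ^ ((1 + η) / 2)) ^ 2 := by
        rw [mul_pow, Real.sq_sqrt hC, ← Real.rpow_natCast, ← Real.rpow_mul hx0.le]
        have : (1 + η) / 2 * ((2 : ℕ) : ℝ) = 1 + η := by push_cast; ring
        rw [this, Real.rpow_add hx0, Real.rpow_one]
        ring

/-- Partial summation against the weights `1 / (n (n + 1))`. -/
theorem sum_Ioc_div_le_partial_summation {a : ℕ → ℝ} (ha : ∀ n, 0 ≤ a n) {D N : ℕ}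
    (hDN : D ≤ N) :
    ∑ n ∈ Finset.Ioc D N, a n / ((n : ℝ) * (n + 1)) ≤
      (∑ n ∈ Finset.Icc 1 N, a n) / (((N : ℝ) + 1) * (N + 2)) +
        ∑ n ∈ Finset.Ioc D N,
          (∑ m ∈ Finset.Icc 1 n, a m) * (2 / ((n : ℝ) * (n + 1) * (n + 2))) := by
  induction N, hDN using Nat.le_induction with
  | base =>
    have := Finset.sum_nonneg (s := Finset.Icc 1 D) fun n _ => ha n
    simp only [Finset.Ioc_self, Finset.sum_empty, add_zero]
    positivity
  | succ N hN ih =>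
    rw [← Finset.insert_Ioc_right_eq_Ioc_add_one (by omega), Finset.sum_insert (by simp),
      Finset.sum_insert (by simp), Finset.sum_Icc_succ_top (by omega)]
    set S := ∑ n ∈ Finset.Icc 1 N, a n
    have key : a (N + 1) / (((N + 1 : ℕ) : ℝ) * ((N + 1 : ℕ) + 1)) + S / (((N : ℝ) + 1) * (N + 2))
        = (S + a (N + 1)) / ((((N + 1 : ℕ) : ℝ) + 1) * ((N + 1 : ℕ) + 2)) +
          (S + a (N + 1)) *
            (2 / (((N + 1 : ℕ) : ℝ) * ((N + 1 : ℕ) + 1) * ((N + 1 : ℕ) + 2))) := by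
      push_cast
      field_simp
      ring
    linarith

theorem sum_Ioc_div_le_of_sum_le_rpow {a : ℕ → ℝ} (ha : ∀ n, 0 ≤ a n) {B : ℝ} (hB : 0 ≤ B)
    {D : ℕ} (hS : ∀ n, D < n → ∑ m ∈ Finset.Icc 1 n, a m ≤ B * (n : ℝ) ^ (3 / 2 : ℝ)) (N : ℕ) :
    ∑ n ∈ Finset.Ioc D N, a n / ((n : ℝ) * (n + 1)) ≤
      B * (1 + 2 * ∑' n : ℕ, 1 / (n : ℝ) ^ (3 / 2 : ℝ)) := by
  have hsum : Summable fun n : ℕ => 1 / (n : ℝ) ^ (3 / 2 : ℝ) :=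
    Real.summable_one_div_nat_rpow.2 (by norm_num)
  have hZ : 0 ≤ ∑' n : ℕ, 1 / (n : ℝ) ^ (3 / 2 : ℝ) := tsum_nonneg fun n => by positivity
  rcases le_or_gt N D with hND | hDN
  · rw [Finset.Ioc_eq_empty_of_le hND, Finset.sum_empty]
    positivity
  refine (sum_Ioc_div_le_partial_summation ha hDN.le).trans ?_
  rw [mul_add B, mul_one]
  refine add_le_add ?_ ?_
  · rw [div_le_iff₀ (by positivity)]
    refine (hS N hDN).trans (mul_le_mul_of_nonneg_left ?_ hB)
    have h1 : (1 : ℝ) ≤ N := by exact_mod_cast (by omega : 1 ≤ N)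
    calc (N : ℝ) ^ (3 / 2 : ℝ) ≤ (N : ℝ) ^ (2 : ℝ) :=
          Real.rpow_le_rpow_of_exponent_le h1 (by norm_num)
      _ = (N : ℝ) ^ 2 := by norm_cast
      _ ≤ ((N : ℝ) + 1) * (N + 2) := by nlinarith
  · calc ∑ n ∈ Finset.Ioc D N,
          (∑ m ∈ Finset.Icc 1 n, a m) * (2 / ((n : ℝ) * (n + 1) * (n + 2)))
        ≤ ∑ n ∈ Finset.Ioc D N, B * (2 * (1 / (n : ℝ) ^ (3 / 2 : ℝ))) := by
          refine Finset.sum_le_sum fun n hn => ?_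
          have hDn := (Finset.mem_Ioc.1 hn).1
          have h0 : (0 : ℝ) < n := by exact_mod_cast (by omega : 0 < n)
          have hp : (0 : ℝ) < (n : ℝ) ^ (3 / 2 : ℝ) := by positivity
          have hpp : (n : ℝ) ^ (3 / 2 : ℝ) * (n : ℝ) ^ (3 / 2 : ℝ) = (n : ℝ) ^ 3 := by
            rw [← Real.rpow_add h0]; norm_num
          calc _ ≤ (B * (n : ℝ) ^ (3 / 2 : ℝ)) * (2 / (n : ℝ) ^ 3) := by
                gcongr
                · exact hS n hDn
                · nlinarith [sq_nonneg (n : ℝ)]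
            _ = _ := by
                rw [← hpp]
                field_simp
      _ = B * (2 * ∑ n ∈ Finset.Ioc D N, 1 / (n : ℝ) ^ (3 / 2 : ℝ)) := by
          simp_rw [← Finset.mul_sum]
      _ ≤ _ := by
          gcongr
          exact hsum.sum_le_tsum _ fun n _ => by positivity

/-- If `∑_{m ≤ n} |f(m)|` grows at most like `A n ^ (3/2)`, the series defining `C_f` converges,
and a bound `B n ^ (3/2)` beyond `D` controls its tail. -/
theorem norm_tsum_sub_sum_le (f : ℕ → ℂ) {A B : ℝ} (hA : 0 ≤ A) (hB : 0 ≤ B)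
    (hSA : ∀ n, 0 < n → ∑ m ∈ Finset.Icc 1 n, ‖f m‖ ≤ A * (n : ℝ) ^ (3 / 2 : ℝ)) {D : ℕ}
    (hSB : ∀ n, D < n → ∑ m ∈ Finset.Icc 1 n, ‖f m‖ ≤ B * (n : ℝ) ^ (3 / 2 : ℝ)) :
    ‖∑ n ∈ Finset.Icc 1 D, f n / ((n : ℂ) * (n + 1)) -
        ∑' n : ℕ, f (n + 1) / (((n : ℂ) + 1) * ((n : ℂ) + 2))‖ ≤
      B * (1 + 2 * ∑' n : ℕ, 1 / (n : ℝ) ^ (3 / 2 : ℝ)) := by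
  have hnorm (n : ℕ) : ‖f n / ((n : ℂ) * (n + 1))‖ = ‖f n‖ / ((n : ℝ) * (n + 1)) := by
    rw [norm_div, norm_mul, Complex.norm_natCast]
    congr 2
    exact_mod_cast Complex.norm_natCast (n + 1)
  have hterm (n : ℕ) : f (n + 1) / (((n : ℂ) + 1) * ((n : ℂ) + 2)) =
      f (n + 1) / (((n + 1 : ℕ) : ℂ) * ((n + 1 : ℕ) + 1)) := by
    push_cast; ring
  have hrange {E : Type} [AddCommMonoid E] (g : ℕ → E) (N : ℕ) :
      ∑ n ∈ Finset.range N, g (n + 1) = ∑ n ∈ Finset.Icc 1 N, g n := by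
    rw [Finset.range_eq_Ico, Finset.sum_Ico_add' g 0 N 1]
    rfl
  simp_rw [hterm]
  have hsum : Summable fun n : ℕ => f (n + 1) / (((n + 1 : ℕ) : ℂ) * ((n + 1 : ℕ) + 1)) := by
    refine Summable.of_norm (summable_of_sum_range_le
      (c := A * (1 + 2 * ∑' n : ℕ, 1 / (n : ℝ) ^ (3 / 2 : ℝ))) (fun n => norm_nonneg _)
      fun N => ?_)
    rw [hrange (fun n => ‖f n / ((n : ℂ) * (n + 1))‖)]
    simp_rw [hnorm]
    exact sum_Ioc_div_le_of_sum_le_rpow (fun n => norm_nonneg (f n)) hA (D := 0) hSA N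
  have hlim := hsum.hasSum.tendsto_sum_nat
  refine le_of_tendsto ((tendsto_const_nhds.sub hlim).norm) ?_
  filter_upwards [eventually_ge_atTop D] with N hN
  rw [hrange (fun n => f n / ((n : ℂ) * (n + 1))), norm_sub_rev]
  have hsplit : ∑ n ∈ Finset.Icc 1 N, f n / ((n : ℂ) * (n + 1)) -
      ∑ n ∈ Finset.Icc 1 D, f n / ((n : ℂ) * (n + 1)) =
      ∑ n ∈ Finset.Ioc D N, f n / ((n : ℂ) * (n + 1)) := by
    have h := Finset.sum_Ioc_consecutive (fun n => f n / ((n : ℂ) * (n + 1))) (Nat.zero_le D) hN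
    exact sub_eq_iff_eq_add'.2 h.symm
  rw [hsplit]
  refine (norm_sum_le _ _).trans ?_
  simp_rw [hnorm]
  exact sum_Ioc_div_le_of_sum_le_rpow (fun n => norm_nonneg (f n)) hB hSB N

theorem filter_floor_div_eq {x : ℝ} (hx : 0 ≤ x) (M : ℕ) {d : ℕ} (hd : 0 < d) :
    (Finset.Ioc M ⌊x⌋₊).filter (fun n : ℕ => ⌊x / (n : ℝ)⌋₊ = d) =
      Finset.Ioc (max M ⌊x / ((d : ℝ) + 1)⌋₊) ⌊x / (d : ℝ)⌋₊ := by
  ext n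
  have hd' : (0 : ℝ) < d := by exact_mod_cast hd
  have hd1 : (1 : ℝ) ≤ d := by exact_mod_cast hd
  simp only [Finset.mem_filter, Finset.mem_Ioc, max_lt_iff]
  rcases Nat.eq_zero_or_pos n with rfl | hn
  · simp
  have hn' : (0 : ℝ) < n := by exact_mod_cast hn
  rw [Nat.floor_eq_iff (by positivity), Nat.floor_lt (by positivity),
    Nat.le_floor_iff hx, Nat.le_floor_iff (by positivity : 0 ≤ x / (d : ℝ)), le_div_iff₀ hn',
    div_lt_iff₀ hn',
    div_lt_iff₀ (by positivity), le_div_iff₀ hd']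
  constructor
  · rintro ⟨⟨h1, h2⟩, h3, h4⟩
    exact ⟨⟨h1, by linarith⟩, by linarith⟩
  · rintro ⟨⟨h1, h2⟩, h3⟩
    exact ⟨⟨h1, by nlinarith⟩, by linarith, by linarith⟩

/-- Each value `d ≤ y²` is taken by `⌊y³ / n⌋`, `n > y`, about `y³ / (d (d + 1))` times. -/
theorem abs_card_filter_floor_div_sub_le {y : ℝ} (hy : 1 ≤ y) {d : ℕ} (hd : 0 < d)
    (hdy : (d : ℝ) ≤ y ^ 2) :
    |((((Finset.Ioc ⌊y⌋₊ ⌊y ^ 3⌋₊).filter (fun n : ℕ => ⌊y ^ 3 / (n : ℝ)⌋₊ = d)).card : ℕ) : ℝ) -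
      y ^ 3 / ((d : ℝ) * (d + 1))| ≤ 3 := by
  have hy0 : 0 < y := by linarith
  have hd' : (0 : ℝ) < d := by exact_mod_cast hd
  have hyd : y ≤ y ^ 3 / d := by
    rw [le_div_iff₀ hd']
    nlinarith
  have hyd1 : y - 1 ≤ y ^ 3 / (d + 1) := by
    rw [le_div_iff₀ (by positivity)]
    nlinarith
  have hmono : y ^ 3 / ((d : ℝ) + 1) ≤ y ^ 3 / d := by gcongr; linarith
  have hle : max ⌊y⌋₊ ⌊y ^ 3 / ((d : ℝ) + 1)⌋₊ ≤ ⌊y ^ 3 / (d : ℝ)⌋₊ :=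
    max_le (Nat.floor_mono hyd) (Nat.floor_mono hmono)
  have heq : y ^ 3 / ((d : ℝ) * (d + 1)) = y ^ 3 / d - y ^ 3 / (d + 1) := by
    field_simp
    ring
  rw [filter_floor_div_eq (by positivity) _ hd, Nat.card_Ioc, Nat.cast_sub hle, Nat.cast_max, heq]
  have h1 := Nat.floor_le hy0.le
  have h2 := Nat.floor_le (show 0 ≤ y ^ 3 / (d : ℝ) by positivity)
  have h3 := Nat.floor_le (show 0 ≤ y ^ 3 / ((d : ℝ) + 1) by positivity)
  have h4 := Nat.lt_floor_add_one (y ^ 3 / (d : ℝ))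
  have h5 := Nat.lt_floor_add_one (y ^ 3 / ((d : ℝ) + 1))
  have h6 := le_max_right (⌊y⌋₊ : ℝ) (⌊y ^ 3 / ((d : ℝ) + 1)⌋₊ : ℝ)
  have h7 : max (⌊y⌋₊ : ℝ) (⌊y ^ 3 / ((d : ℝ) + 1)⌋₊ : ℝ) ≤ y ^ 3 / ((d : ℝ) + 1) + 1 :=
    max_le (by linarith) (by linarith)
  rw [abs_le]
  constructor <;> linarith

theorem sum_floor_div_eq_sum_card_mul (f : ℕ → ℂ) {y : ℝ} (hy : 1 ≤ y) :
    ∑ n ∈ Finset.Ioc ⌊y⌋₊ ⌊y ^ 3⌋₊, f ⌊y ^ 3 / (n : ℝ)⌋₊ =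
      ∑ d ∈ Finset.Icc 1 ⌊y ^ 2⌋₊,
        ((((Finset.Ioc ⌊y⌋₊ ⌊y ^ 3⌋₊).filter (fun n : ℕ => ⌊y ^ 3 / (n : ℝ)⌋₊ = d)).card : ℕ) : ℂ) *
          f d := by
  have hy0 : 0 < y := by linarith
  rw [← Finset.sum_fiberwise_of_maps_to (t := Finset.Icc 1 ⌊y ^ 2⌋₊)
    (g := fun n : ℕ => ⌊y ^ 3 / (n : ℝ)⌋₊)]
  · refine Finset.sum_congr rfl fun d _ => ?_
    rw [Finset.sum_congr rfl fun n hn => congrArg f (Finset.mem_filter.1 hn).2,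
      Finset.sum_const, nsmul_eq_mul]
  · intro n hn
    obtain ⟨h1, h2⟩ := Finset.mem_Ioc.1 hn
    have h1' : y < n := (Nat.floor_lt hy0.le).1 h1
    have h2' : (n : ℝ) ≤ y ^ 3 := (Nat.le_floor_iff (by positivity)).1 h2
    have hn0 : (0 : ℝ) < n := hy0.trans h1'
    refine Finset.mem_Icc.2 ⟨?_, Nat.floor_mono ?_⟩
    · rw [Nat.one_le_floor_iff, le_div_iff₀ hn0]
      linarith
    · rw [div_le_iff₀ hn0]
      nlinarith [sq_nonneg y]

/-- If `∑_{n ≤ x} |f(n)|² ≤ C x^η` for all `x ≥ 1` with `η ∈ (0,2)`, then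
`∑_{x^{1/3} < n ≤ x} f(⌊x/n⌋) = C_f x + O(x^{(1+η)/3})` as `x → ∞`, where
`C_f = ∑_{n=1}^∞ f(n)/(n(n+1))`. -/
theorem large_range_asymptotic (f : ℕ → ℂ) (η : ℝ) (hη₀ : 0 < η) (hη₂ : η < 2)
    (C : ℝ) (hC : 0 < C)
    (hf : ∀ x : ℝ, 1 ≤ x → ∑ n ∈ Finset.Icc 1 ⌊x⌋₊, ‖f n‖ ^ 2 ≤ C * x ^ η) :
    (fun x : ℝ => (∑ n ∈ Finset.Ioc ⌊x ^ ((1 : ℝ) / 3)⌋₊ ⌊x⌋₊, f ⌊x / (n : ℝ)⌋₊) -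
        (∑' n : ℕ, f (n + 1) / (((n : ℂ) + 1) * ((n : ℂ) + 2))) * (x : ℂ))
      =O[atTop] fun x : ℝ => x ^ ((1 + η) / 3) := by
  have hS (x : ℝ) (hx : 1 ≤ x) := sum_norm_le_of_sum_sq_le f hC.le hx (hf x hx)
  have hSA (n : ℕ) (hn : 0 < n) :
      ∑ m ∈ Finset.Icc 1 n, ‖f m‖ ≤ √C * (n : ℝ) ^ (3 / 2 : ℝ) := by
    have h1 : (1 : ℝ) ≤ n := by exact_mod_cast hn
    have h := hS n h1
    rw [Nat.floor_natCast] at h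
    refine h.trans ?_
    exact mul_le_mul_of_nonneg_left
      (Real.rpow_le_rpow_of_exponent_le h1 (by linarith)) (Real.sqrt_nonneg C)
  set Z := ∑' n : ℕ, 1 / (n : ℝ) ^ (3 / 2 : ℝ)
  refine IsBigO.of_bound (3 * √C + √C * (1 + 2 * Z)) ?_
  filter_upwards [eventually_ge_atTop 1] with x hx
  have hx0 : 0 < x := by linarith
  obtain ⟨y, hy, rfl, hroot⟩ : ∃ y : ℝ, 1 ≤ y ∧ y ^ 3 = x ∧ x ^ ((1 : ℝ) / 3) = y :=
    ⟨x ^ ((1 : ℝ) / 3), Real.one_le_rpow hx (by norm_num), by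
      rw [← Real.rpow_natCast, ← Real.rpow_mul hx0.le]; norm_num, rfl⟩
  have hy0 : 0 < y := by linarith
  have hpow : (y ^ 3) ^ ((1 + η) / 3) = y ^ (1 + η) := by
    rw [← Real.rpow_natCast, ← Real.rpow_mul hy0.le]
    congr 1
    push_cast
    ring
  have hsq (s : ℝ) : (y ^ 2) ^ s = y ^ (2 * s) := by
    rw [← Real.rpow_natCast, ← Real.rpow_mul hy0.le]
    norm_num
  rw [hroot, sum_floor_div_eq_sum_card_mul f hy, Real.norm_of_nonneg (by positivity), hpow]
  set Cf := ∑' n : ℕ, f (n + 1) / (((n : ℂ) + 1) * ((n : ℂ) + 2))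
  set c : ℕ → ℕ := fun d =>
    ((Finset.Ioc ⌊y⌋₊ ⌊y ^ 3⌋₊).filter (fun n : ℕ => ⌊y ^ 3 / (n : ℝ)⌋₊ = d)).card
  have htail : ‖∑ n ∈ Finset.Icc 1 ⌊y ^ 2⌋₊, f n / ((n : ℂ) * (n + 1)) - Cf‖ ≤
      √C * y ^ (η - 2) * (1 + 2 * Z) := by
    refine norm_tsum_sub_sum_le f (Real.sqrt_nonneg C) (by positivity) hSA fun n hn => ?_
    have hn' : y ^ 2 < n := (Nat.floor_lt (by positivity)).1 hn
    have hn1 : (1 : ℝ) ≤ n := by nlinarith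
    have h := hS n hn1
    rw [Nat.floor_natCast] at h
    refine h.trans ?_
    rw [mul_assoc]
    gcongr
    calc (n : ℝ) ^ ((1 + η) / 2) = (n : ℝ) ^ ((η - 2) / 2) * (n : ℝ) ^ (3 / 2 : ℝ) := by
          rw [← Real.rpow_add (by linarith)]
          congr 1
          ring
      _ ≤ (y ^ 2) ^ ((η - 2) / 2) * (n : ℝ) ^ (3 / 2 : ℝ) := by
          gcongr ?_ * _
          exact Real.rpow_le_rpow_of_nonpos (by positivity) hn'.le (by linarith)
      _ = y ^ (η - 2) * (n : ℝ) ^ (3 / 2 : ℝ) := by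
          rw [hsq]
          congr 2
          ring
  have herr : ‖∑ d ∈ Finset.Icc 1 ⌊y ^ 2⌋₊,
      ((c d : ℂ) - (y ^ 3 : ℝ) / ((d : ℂ) * (d + 1))) * f d‖ ≤ 3 * (√C * y ^ (1 + η)) := by
    calc _ ≤ ∑ d ∈ Finset.Icc 1 ⌊y ^ 2⌋₊, 3 * ‖f d‖ := by
          refine norm_sum_le_of_le _ fun d hd => ?_
          obtain ⟨h1, h2⟩ := Finset.mem_Icc.1 hd
          rw [norm_mul]
          gcongr
          have h := abs_card_filter_floor_div_sub_le hy h1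
            ((Nat.le_floor_iff (by positivity)).1 h2)
          rw [← Real.norm_eq_abs, ← Complex.norm_real] at h
          push_cast at h ⊢
          exact h
      _ ≤ 3 * (√C * y ^ (1 + η)) := by
          rw [← Finset.mul_sum]
          have h := hS (y ^ 2) (one_le_pow₀ hy)
          rw [hsq, mul_div_cancel₀ _ two_ne_zero] at h
          gcongr
  have hsplit : ∑ d ∈ Finset.Icc 1 ⌊y ^ 2⌋₊, (c d : ℂ) * f d - Cf * ((y ^ 3 : ℝ) : ℂ) =
      ∑ d ∈ Finset.Icc 1 ⌊y ^ 2⌋₊, ((c d : ℂ) - (y ^ 3 : ℝ) / ((d : ℂ) * (d + 1))) * f d +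
        (∑ n ∈ Finset.Icc 1 ⌊y ^ 2⌋₊, f n / ((n : ℂ) * (n + 1)) - Cf) * ((y ^ 3 : ℝ) : ℂ) := by
    rw [sub_mul, Finset.sum_mul, ← add_sub_assoc, ← Finset.sum_add_distrib]
    congr 1
    refine Finset.sum_congr rfl fun d _ => ?_
    ring
  have hcomb : y ^ (η - 2) * y ^ 3 = y ^ (1 + η) := by
    rw [← Real.rpow_natCast, ← Real.rpow_add hy0]
    congr 1
    push_cast
    ring
  rw [hsplit]
  refine (norm_add_le _ _).trans ?_
  rw [norm_mul, Complex.norm_real, Real.norm_of_nonneg (by positivity : 0 ≤ y ^ 3)]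
  calc _ ≤ 3 * (√C * y ^ (1 + η)) + √C * y ^ (η - 2) * (1 + 2 * Z) * y ^ 3 := by gcongr
    _ = (3 * √C + √C * (1 + 2 * Z)) * y ^ (1 + η) := by
        rw [← hcomb]
        ring
end

section
/- Let κ, λ be real numbers with 0 < κ ≤ 1/2 ≤ λ < 1 such that (κ,λ) satisfies the exponential-sum hypothesis for δ = 0 and for δ = 1. Let g be an arithmetic function with ∑_{n ≤ x} |g(n)| = O(x^{λ/(1+κ)}) for x ≥ 1, and let f be a positive real-valued arithmetic function with f(n) = ∑_{d|n} g(d) for all n, satisfying f(n) = O(1). Then S_f(x) = C_f · x + O(x^{λ/(1+λ)} (log x)²) as x → ∞. -/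
open Finset Real Filter Asymptotics

/-- Additive character `e(θ) = e^{2πiθ}`. -/
noncomputable def eChar (θ : ℝ) : ℂ := Complex.exp (2 * Real.pi * Complex.I * θ)

/-- The pair `(κ,λ)` with `0 < κ ≤ 1/2 ≤ λ < 1` satisfies the exponential-sum hypothesis
for `δ ≥ 0` with constant `A`: for all `T ≥ 1`, positive integers `m` and `X ≥ 1`,
`|∑_{X < n ≤ 2X} e(T/(mn+δ))| ≤ A ((T/(mX²))^κ X^λ + mX²/T)`. -/
def ExpSumHyp (δ κ lam A : ℝ) : Prop :=
  ∀ T : ℝ, 1 ≤ T → ∀ m : ℕ, 0 < m → ∀ X : ℝ, 1 ≤ X →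
    ‖∑ n ∈ Finset.Ioc ⌊X⌋₊ ⌊2 * X⌋₊, eChar (T / (m * n + δ))‖ ≤
      A * ((T / (m * X ^ 2)) ^ κ * X ^ lam + m * X ^ 2 / T)


lemma eChar_add (a b : ℝ) : eChar (a + b) = eChar a * eChar b := by
  simp only [eChar, ← Complex.exp_add]
  push_cast
  ring_nf

lemma eChar_eq (θ : ℝ) : eChar θ = Complex.exp (Complex.I * ((2 * π * θ : ℝ) : ℂ)) := by
  simp only [eChar]
  push_cast
  ring_nf

lemma eChar_re (θ : ℝ) : (eChar θ).re = cos (2 * π * θ) := by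
  rw [eChar_eq, mul_comm, Complex.exp_ofReal_mul_I_re]

lemma norm_eChar_sub_one_le (θ : ℝ) : ‖eChar θ - 1‖ ≤ 2 * π * min 1 |θ| := by
  have h1 : ‖eChar θ - 1‖ ≤ 2 * π * |θ| := by
    rw [eChar_eq]
    refine Real.norm_exp_I_mul_ofReal_sub_one_le.trans_eq ?_
    rw [Real.norm_eq_abs, abs_mul, abs_of_pos Real.two_pi_pos]
  have h2 : ‖eChar θ - 1‖ ≤ 2 := by
    rw [eChar_eq, Complex.norm_exp_I_mul_ofReal_sub_one, norm_mul, Real.norm_eq_abs,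
      Real.norm_eq_abs, abs_of_pos (two_pos : (0 : ℝ) < 2)]
    linarith [Real.abs_sin_le_one (2 * π * θ / 2)]
  rcases le_total 1 |θ| with h | h
  · rw [min_eq_left h]
    linarith [Real.pi_gt_three]
  · rwa [min_eq_right h]

lemma abs_sum_cos_sub_cos_le {ι : Type*} (s : Finset ι) (u : ι → ℝ) (h Δ : ℝ) :
    |∑ i ∈ s, (cos (2 * π * h * (u i + Δ)) - cos (2 * π * h * u i))| ≤
      2 * π * min 1 |h * Δ| * ‖∑ i ∈ s, eChar (h * u i)‖ := by
  have key : ∑ i ∈ s, (cos (2 * π * h * (u i + Δ)) - cos (2 * π * h * u i)) =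
      ((eChar (h * Δ) - 1) * ∑ i ∈ s, eChar (h * u i)).re := by
    rw [Finset.mul_sum, Complex.re_sum]
    refine Finset.sum_congr rfl fun i _ => ?_
    rw [sub_mul, one_mul, ← eChar_add, Complex.sub_re, eChar_re, eChar_re]
    ring_nf
  rw [key]
  refine (Complex.abs_re_le_norm _).trans ?_
  rw [norm_mul]
  gcongr
  exact norm_eChar_sub_one_le _

lemma hasSum_cos_div_sq (u : ℝ) :
    HasSum (fun n : ℕ => 1 / (n : ℝ) ^ 2 * cos (2 * π * n * u))
      (π ^ 2 * (Int.fract u ^ 2 - Int.fract u + 1 / 6)) := by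
  have h := hasSum_one_div_nat_pow_mul_cos one_ne_zero
    (x := Int.fract u) ⟨Int.fract_nonneg u, (Int.fract_lt_one u).le⟩
  have hB : (Polynomial.map (algebraMap ℚ ℝ) (Polynomial.bernoulli (2 * 1))).eval (Int.fract u) =
      Int.fract u ^ 2 - Int.fract u + 1 / 6 := by
    simp [Polynomial.bernoulli, Finset.sum_range_succ, bernoulli_eq_bernoulli'_of_ne_one,
      bernoulli'_two, _root_.bernoulli_one]
    ring
  rw [hB] at h
  convert h using 1
  · funext n
    rw [mul_one]
    congr 1
    have : 2 * π * n * Int.fract u = 2 * π * n * u - ((n * ⌊u⌋ : ℤ) : ℝ) * (2 * π) := by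
      rw [Int.fract]
      push_cast
      ring
    rw [this, Real.cos_sub_int_mul_two_pi]
  · norm_num [Nat.factorial]
    exact Or.inl (by ring)

lemma fract_sq_sub_fract_add_le (u Δ : ℝ) :
    Int.fract (u + Δ) ^ 2 - Int.fract (u + Δ) ≤
      Int.fract u ^ 2 - Int.fract u + 2 * Δ * (Int.fract u - 1 / 2) + Δ ^ 2 := by
  obtain ⟨k, hk⟩ : ∃ k : ℤ, Int.fract u + Δ = Int.fract (u + Δ) + k :=
    ⟨⌊u + Δ⌋ - ⌊u⌋, by simp only [Int.fract]; push_cast; ring⟩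
  have hΔ : Δ = Int.fract (u + Δ) + k - Int.fract u := by linarith
  set w := Int.fract (u + Δ) with hw
  have hw0 : 0 ≤ w := Int.fract_nonneg _
  have hw1 : w ≤ 1 := (Int.fract_lt_one _).le
  have main : 0 ≤ (k : ℝ) * (k - 1) + 2 * k * w := by
    rcases le_or_gt 1 k with h | h
    · have : (1 : ℝ) ≤ k := by exact_mod_cast h
      have h1 := mul_nonneg (zero_le_one.trans this) (sub_nonneg.2 this)
      have h2 := mul_nonneg (zero_le_one.trans this) hw0
      linarith
    · rcases eq_or_lt_of_le (Int.lt_add_one_iff.1 (by simpa using h) : k ≤ 0) with h0 | h0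
      · simp [h0]
      · have : (k : ℝ) ≤ -1 := by exact_mod_cast (by omega : k ≤ -1)
        nlinarith [mul_nonneg (by linarith : (0 : ℝ) ≤ -k) (by linarith : 0 ≤ 1 - w)]
  rw [hΔ]
  nlinarith

lemma HasSum.abs_le_of_partial {F G : ℕ → ℝ} {a W : ℝ} (hF : HasSum F a)
    (hFG : ∀ n, |F n| ≤ G n) (hW : ∀ n, ∑ h ∈ Finset.range n, G h ≤ W) : |a| ≤ W :=
  le_of_tendsto hF.tendsto_sum_nat.abs (Eventually.of_forall fun n =>
    (Finset.abs_sum_le_sum_abs _ _).trans ((Finset.sum_le_sum fun i _ => hFG i).trans (hW n)))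

/-- The sawtooth sum is controlled by the exponential sums at all positive frequencies, with
weights decaying beyond frequency `H`. -/
lemma abs_sum_sawtooth_le {ι : Type*} (s : Finset ι) (u : ι → ℝ) {H : ℕ} (hH : 0 < H)
    (c : ℕ → ℝ) (hc : ∀ h : ℕ, 0 < h → ‖∑ i ∈ s, eChar (h * u i)‖ ≤ c h) {W : ℝ}
    (hW : ∀ n, ∑ h ∈ Finset.range n, min 1 ((h : ℝ) / H) / (h : ℝ) ^ 2 * c h ≤ W) :
    |∑ i ∈ s, (Int.fract (u i) - 1 / 2)| ≤ s.card / H + H * W := by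
  have hH' : (0 : ℝ) < H := by exact_mod_cast hH
  have hWn : 0 ≤ W := by simpa using hW 0
  have bound : ∀ Δ : ℝ, |Δ| = 1 / H →
      |∑ i ∈ s, ((Int.fract (u i + Δ) ^ 2 - Int.fract (u i + Δ)) -
        (Int.fract (u i) ^ 2 - Int.fract (u i)))| ≤ W := by
    intro Δ hΔ
    have hs : HasSum (fun n : ℕ => ∑ i ∈ s, 1 / (n : ℝ) ^ 2 *
        (cos (2 * π * n * (u i + Δ)) - cos (2 * π * n * u i)))
        (∑ i ∈ s, π ^ 2 * ((Int.fract (u i + Δ) ^ 2 - Int.fract (u i + Δ)) -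
        (Int.fract (u i) ^ 2 - Int.fract (u i)))) := by
      refine hasSum_sum fun i _ => ?_
      have h0 := (hasSum_cos_div_sq (u i + Δ)).sub (hasSum_cos_div_sq (u i))
      simp only [← mul_sub] at h0
      rwa [add_sub_add_right_eq_sub] at h0
    have := hs.abs_le_of_partial (W := 2 * π * W)
      (G := fun h : ℕ => 2 * π * (min 1 ((h : ℝ) / H) / (h : ℝ) ^ 2 * c h)) ?_ ?_
    · rw [← Finset.mul_sum, abs_mul, abs_of_pos (by positivity)] at this
      have h3 := Real.pi_gt_three
      set Y := |∑ i ∈ s, ((Int.fract (u i + Δ) ^ 2 - Int.fract (u i + Δ)) -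
        (Int.fract (u i) ^ 2 - Int.fract (u i)))|
      have h4 : π * Y ≤ 2 * W := by
        refine le_of_mul_le_mul_left (a := π) ?_ Real.pi_pos
        linarith
      have hY : 0 ≤ Y := abs_nonneg _
      nlinarith
    · intro n
      rcases Nat.eq_zero_or_pos n with rfl | hn
      · simp
      have hn' : (0 : ℝ) < n := by exact_mod_cast hn
      rw [← Finset.mul_sum, abs_mul, abs_of_pos (by positivity)]
      have h1 := abs_sum_cos_sub_cos_le s u n Δ
      rw [abs_mul, hΔ, abs_of_pos hn', mul_one_div] at h1
      calc 1 / (n : ℝ) ^ 2 * |∑ i ∈ s, (cos (2 * π * n * (u i + Δ)) - cos (2 * π * n * u i))|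
          ≤ 1 / (n : ℝ) ^ 2 * (2 * π * min 1 ((n : ℝ) / H) * c n) := by
            gcongr
            refine h1.trans ?_
            gcongr
            exact hc n hn
        _ = _ := by ring
    · intro n
      rw [← Finset.mul_sum]
      have := hW n
      gcongr
  have lower : ∀ Δ : ℝ, |Δ| = 1 / H →
      -W ≤ 2 * Δ * ∑ i ∈ s, (Int.fract (u i) - 1 / 2) + s.card * Δ ^ 2 := by
    intro Δ hΔ
    refine (neg_le_of_abs_le (bound Δ hΔ)).trans ?_
    rw [Finset.mul_sum, ← nsmul_eq_mul, ← Finset.sum_const, ← Finset.sum_add_distrib]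
    exact Finset.sum_le_sum fun i _ => by linarith [fract_sq_sub_fract_add_le (u i) Δ]
  have l1 := lower (1 / H) (abs_of_pos (by positivity))
  have l2 := lower (-(1 / H)) (by rw [abs_neg]; exact abs_of_pos (by positivity))
  set S := ∑ i ∈ s, (Int.fract (u i) - 1 / 2)
  have e1 : 2 * (S * (1 / H)) ≤ W + s.card * (1 / H) ^ 2 := by nlinarith
  have e2 : -(2 * (S * (1 / H))) ≤ W + s.card * (1 / H) ^ 2 := by nlinarith
  have e3 : 2 * |S| ≤ H * (W + s.card * (1 / H) ^ 2) := by
    have hS : S = H * (S * (1 / H)) := by field_simp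
    rcases abs_cases S with ⟨h, _⟩ | ⟨h, _⟩ <;> rw [h]
    · calc 2 * S = H * (2 * (S * (1 / H))) := by field_simp
        _ ≤ _ := by gcongr
    · calc 2 * -S = H * (-(2 * (S * (1 / H)))) := by field_simp
        _ ≤ _ := by gcongr
  have e4 : H * (W + s.card * (1 / H : ℝ) ^ 2) = H * W + s.card / H := by field_simp
  have e5 : (0 : ℝ) ≤ H * W := by positivity
  have e6 : (0 : ℝ) ≤ s.card / H := by positivity
  linarith

lemma sub_one_rpow_le {s h : ℝ} (hs : 0 ≤ s) (hs1 : s ≤ 1) (hh : 1 ≤ h) :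
    (h - 1) ^ s ≤ h ^ s * (1 - s / h) := by
  have h0 : 0 < h := by linarith
  have h1 : 1 / h ≤ 1 := by rw [div_le_one h0]; exact hh
  have e : h - 1 = h * (1 + -(1 / h)) := by field_simp; ring
  have b := rpow_one_add_le_one_add_mul_self (s := -(1 / h)) (by linarith) hs hs1
  rw [e, Real.mul_rpow h0.le (by linarith)]
  gcongr
  refine b.trans_eq ?_
  ring

lemma sum_weight_rpow_le {κ : ℝ} (hκ₀ : 0 < κ) (hκ : κ ≤ 1 / 2) {H : ℕ} (hH : 0 < H) (n : ℕ) :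
    ∑ h ∈ Finset.range n, min 1 ((h : ℝ) / H) / (h : ℝ) ^ 2 * (h : ℝ) ^ κ ≤
      (1 / κ + 2) * ((H : ℝ) ^ κ / H) := by
  have hH' : (0 : ℝ) < H := by exact_mod_cast hH
  have hHs : 1 / (H : ℝ) ^ (1 - κ) = (H : ℝ) ^ κ / H := by
    rw [Real.rpow_sub hH', Real.rpow_one, one_div_div]
  have small : ∀ n : ℕ, n ≤ H → ∑ h ∈ Finset.range (n + 1),
      min 1 ((h : ℝ) / H) / (h : ℝ) ^ 2 * (h : ℝ) ^ κ ≤ (n : ℝ) ^ κ / (κ * H) := by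
    intro n
    induction n with
    | zero => intro _; simp [Real.zero_rpow hκ₀.ne']
    | succ k ih =>
      intro hk
      rw [Finset.sum_range_succ]
      have h1 := ih (by omega)
      have hk1 : (0 : ℝ) < ((k + 1 : ℕ) : ℝ) := by positivity
      have hb := sub_one_rpow_le (s := κ) (h := ((k + 1 : ℕ) : ℝ)) hκ₀.le (by linarith)
        (by push_cast; linarith [(Nat.cast_nonneg k : (0 : ℝ) ≤ k)])
      rw [show (((k + 1 : ℕ) : ℝ) - 1) = k by push_cast; ring] at hb
      set y : ℝ := ((k + 1 : ℕ) : ℝ) with hy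
      have hmin : min 1 (y / H) = y / H :=
        min_eq_right ((div_le_one hH').2 (by rw [hy]; exact_mod_cast hk))
      rw [hmin]
      calc _ ≤ (k : ℝ) ^ κ / (κ * H) + y / H / y ^ 2 * y ^ κ := by gcongr
        _ ≤ y ^ κ * (1 - κ / y) / (κ * H) + y / H / y ^ 2 * y ^ κ := by gcongr
        _ = _ := by field_simp; ring
  have large : ∀ n : ℕ, H ≤ n → ∑ h ∈ Finset.range (n + 1),
      min 1 ((h : ℝ) / H) / (h : ℝ) ^ 2 * (h : ℝ) ^ κ ≤
        (H : ℝ) ^ κ / (κ * H) + 2 * (1 / (H : ℝ) ^ (1 - κ) - 1 / (n : ℝ) ^ (1 - κ)) := by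
    intro n hn
    induction n, hn using Nat.le_induction with
    | base => simpa using small H le_rfl
    | succ k hk ih =>
      rw [Finset.sum_range_succ]
      have hk0 : (0 : ℝ) < k := by exact_mod_cast (by omega : 0 < k)
      have hb := sub_one_rpow_le (s := 1 - κ) (h := ((k + 1 : ℕ) : ℝ)) (by linarith) (by linarith)
        (by push_cast; linarith)
      rw [show (((k + 1 : ℕ) : ℝ) - 1) = k by push_cast; ring] at hb
      set y : ℝ := ((k + 1 : ℕ) : ℝ) with hy
      have hy0 : 0 < y := by positivity
      have hmin : min 1 (y / H) = 1 :=
        min_eq_left ((one_le_div hH').2 (by rw [hy]; exact_mod_cast (by omega : H ≤ k + 1)))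
      have ey : y ^ κ = y / y ^ (1 - κ) := by
        rw [Real.rpow_sub hy0, Real.rpow_one]; field_simp
      rw [hmin, ey]
      set a := (k : ℝ) ^ (1 - κ)
      set b := y ^ (1 - κ)
      have ha : 0 < a := by positivity
      have hb0 : 0 < b := by positivity
      have step : 1 / y ^ 2 * (y / b) ≤ 2 * (1 / a - 1 / b) := by
        have h1 : 1 / (2 * y * b) ≤ 1 / a - 1 / b := by
          rw [div_sub_div _ _ ha.ne' hb0.ne', div_le_div_iff₀ (by positivity) (by positivity)]
          have h2 : a ≤ b - b / (2 * y) := by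
            refine hb.trans ?_
            have : b / (2 * y) = b * (1 / 2 / y) := by field_simp
            rw [this, ← mul_one_sub]
            gcongr
            linarith
          have h3 : a ≤ b := h2.trans (by have : 0 ≤ b / (2 * y) := by positivity
                                          linarith)
          have h4 : b ≤ (b - a) * (2 * y) := by
            rw [← div_le_iff₀ (by positivity)]; linarith
          nlinarith
        calc 1 / y ^ 2 * (y / b) = 2 * (1 / (2 * y * b)) := by field_simp
          _ ≤ _ := by gcongr
      linarith
  have h1 := large (n + H) (by omega)
  have h2 : ∑ h ∈ Finset.range n, min 1 ((h : ℝ) / H) / (h : ℝ) ^ 2 * (h : ℝ) ^ κ ≤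
      ∑ h ∈ Finset.range (n + H + 1), min 1 ((h : ℝ) / H) / (h : ℝ) ^ 2 * (h : ℝ) ^ κ :=
    Finset.sum_le_sum_of_subset_of_nonneg (Finset.range_mono (by omega))
      fun i _ _ => by positivity
  have h3 : 0 ≤ 1 / ((n + H : ℕ) : ℝ) ^ (1 - κ) := by positivity
  have h4 : (H : ℝ) ^ κ / (κ * H) = 1 / κ * ((H : ℝ) ^ κ / H) := by field_simp
  rw [h4, hHs] at h1
  linarith

lemma sum_weight_inv_le {H : ℕ} (hH : 0 < H) (n : ℕ) :
    ∑ h ∈ Finset.range n, min 1 ((h : ℝ) / H) / (h : ℝ) ^ 2 * (1 / (h : ℝ)) ≤ 2 / (H : ℝ) := by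
  have hH' : (0 : ℝ) < H := by exact_mod_cast hH
  have hsq : ∑ h ∈ Finset.range n, ((h : ℝ) ^ 2)⁻¹ ≤ 2 := by
    rcases Nat.eq_zero_or_pos n with rfl | hn
    · simp
    have := sum_Ioo_inv_sq_le (α := ℝ) 0 n
    rw [Finset.range_eq_Ico, ← Finset.sum_Ioo_add_eq_sum_Ico hn]
    simpa using this
  calc _ ≤ ∑ h ∈ Finset.range n, 1 / (H : ℝ) * ((h : ℝ) ^ 2)⁻¹ := by
        refine Finset.sum_le_sum fun h _ => ?_
        rcases Nat.eq_zero_or_pos h with rfl | hh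
        · simp
        have hh' : (0 : ℝ) < h := by exact_mod_cast hh
        calc min 1 ((h : ℝ) / H) / (h : ℝ) ^ 2 * (1 / h)
            ≤ ((h : ℝ) / H) / (h : ℝ) ^ 2 * (1 / h) := by gcongr; exact min_le_right _ _
          _ = _ := by field_simp
    _ ≤ 1 / (H : ℝ) * 2 := by rw [← Finset.mul_sum]; gcongr
    _ = 2 / H := by ring

lemma abs_fract_sub_half_le (u : ℝ) : |Int.fract u - 1 / 2| ≤ 1 / 2 :=
  abs_le.2 ⟨by linarith [Int.fract_nonneg u], by linarith [Int.fract_lt_one u]⟩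

lemma ExpSumHyp.mono {δ κ lam A A' : ℝ} (h : ExpSumHyp δ κ lam A) (hA : A ≤ A') :
    ExpSumHyp δ κ lam A' := by
  intro T hT m hm X hX
  refine (h T hT m hm X hX).trans ?_
  gcongr

lemma ExpSumHyp.abs_sum_sawtooth_dyadic_le {δ κ lam A : ℝ} (hA0 : 0 ≤ A)
    (hA : ExpSumHyp δ κ lam A) (hκ₀ : 0 < κ) (hκ : κ ≤ 1 / 2) {x : ℝ} (hx : 1 ≤ x)
    {m : ℕ} (hm : 0 < m) {X : ℝ} (hX : 1 ≤ X) :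
    |∑ n ∈ Finset.Ioc ⌊X⌋₊ ⌊2 * X⌋₊, (Int.fract (x / (m * n + δ)) - 1 / 2)| ≤
      (4 + A * (1 / κ + 2)) *
        ((x / m) ^ (κ / (1 + κ)) * X ^ ((lam - κ) / (1 + κ)) + m * X ^ 2 / x) := by
  have hx0 : 0 < x := by linarith
  have hX0 : 0 < X := by linarith
  have hm0 : (0 : ℝ) < m := by exact_mod_cast hm
  set M := (x / m) ^ (κ / (1 + κ)) * X ^ ((lam - κ) / (1 + κ)) with hM
  set E := m * X ^ 2 / x with hE
  set B := (x / (m * X ^ 2)) ^ κ * X ^ lam with hB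
  have hM0 : 0 < M := by positivity
  have hE0 : 0 < E := by positivity
  have hB0 : 0 < B := by positivity
  have hBM : B * (X / M) ^ κ = M := by
    have h1 : M ^ κ * M = (x / m) ^ κ * X ^ (lam - κ) := by
      rw [← Real.rpow_add_one hM0.ne', hM, Real.mul_rpow (by positivity) (by positivity),
        ← Real.rpow_mul (by positivity), ← Real.rpow_mul (by positivity), add_comm κ 1,
        div_mul_cancel₀ _ (by positivity), div_mul_cancel₀ _ (by positivity)]
    have h2 : B * X ^ κ = (x / m) ^ κ * X ^ (lam - κ) := by
      have e : x / (m * X ^ 2) = x / m / (X ^ 2) := by field_simp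
      rw [hB, e, Real.div_rpow (by positivity) (by positivity), sq,
        Real.mul_rpow hX0.le hX0.le, Real.rpow_sub hX0]
      field_simp
    rw [Real.div_rpow hX0.le hM0.le, ← mul_div_assoc, h2, ← h1]
    field_simp
  have hcard : ((Finset.Ioc ⌊X⌋₊ ⌊2 * X⌋₊).card : ℝ) ≤ 2 * X := by
    rw [Nat.card_Ioc]
    exact (Nat.cast_le.2 (Nat.sub_le _ _)).trans (Nat.floor_le (by positivity))
  have hAk : 0 ≤ A * (1 / κ) := by positivity
  rcases lt_or_ge (X / M) 1 with hlt | hge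
  · rw [div_lt_one hM0] at hlt
    calc _ ≤ ∑ n ∈ Finset.Ioc ⌊X⌋₊ ⌊2 * X⌋₊, (1 / 2 : ℝ) :=
          (Finset.abs_sum_le_sum_abs _ _).trans
            (Finset.sum_le_sum fun i _ => abs_fract_sub_half_le _)
      _ ≤ 1 * (M + 0) := by
          rw [Finset.sum_const, nsmul_eq_mul]; linarith
      _ ≤ _ := by
          gcongr
          linarith
  · set H := ⌊X / M⌋₊ with hH
    have hH1 : 0 < H := Nat.floor_pos.2 hge
    have hH0 : (0 : ℝ) < H := by exact_mod_cast hH1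
    have hHle : (H : ℝ) ≤ X / M := Nat.floor_le (by positivity)
    have hHge : X / M ≤ 2 * H := by
      have h1 : X / M < H + 1 := Nat.lt_floor_add_one _
      have h2 : (1 : ℝ) ≤ H := by exact_mod_cast hH1
      linarith
    have hs := abs_sum_sawtooth_le (Finset.Ioc ⌊X⌋₊ ⌊2 * X⌋₊)
      (fun n : ℕ => x / (m * n + δ)) hH1 (fun h => A * (B * (h : ℝ) ^ κ + E * (1 / h))) ?_
      (W := A * (B * ((1 / κ + 2) * ((H : ℝ) ^ κ / H)) + E * (2 / H))) ?_
    · refine hs.trans ?_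
      have h1 : (H : ℝ) * (A * (B * ((1 / κ + 2) * ((H : ℝ) ^ κ / H)) + E * (2 / H))) =
          A * ((1 / κ + 2) * (B * (H : ℝ) ^ κ) + 2 * E) := by field_simp
      have h2 : B * (H : ℝ) ^ κ ≤ M := by
        rw [← hBM]; gcongr
      have h3 : ((Finset.Ioc ⌊X⌋₊ ⌊2 * X⌋₊).card : ℝ) / H ≤ 4 * M := by
        rw [div_le_iff₀ hH0]
        rw [div_le_iff₀ hM0] at hHge
        linarith
      rw [h1]
      calc _ ≤ 4 * M + A * ((1 / κ + 2) * M + (1 / κ + 2) * E) := by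
            gcongr
            have : 0 < 1 / κ := by positivity
            linarith
        _ ≤ _ := by linarith
    · intro h hh
      have hh1 : (1 : ℝ) ≤ h := by exact_mod_cast hh
      have hh0 : (0 : ℝ) < h := by linarith
      have := hA (h * x) (by nlinarith) m hm X hX
      simp only [mul_div_assoc] at this ⊢
      refine this.trans_eq ?_
      rw [Real.mul_rpow hh0.le (by positivity), hB, hE]
      field_simp
    · intro n
      have h1 := sum_weight_rpow_le hκ₀ hκ hH1 n
      have h2 := sum_weight_inv_le hH1 n
      calc _ = A * (B * ∑ h ∈ Finset.range n, min 1 ((h : ℝ) / H) / (h : ℝ) ^ 2 * (h : ℝ) ^ κ +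
            E * ∑ h ∈ Finset.range n, min 1 ((h : ℝ) / H) / (h : ℝ) ^ 2 * (1 / h)) := by
            rw [Finset.mul_sum, Finset.mul_sum, ← Finset.sum_add_distrib, Finset.mul_sum]
            exact Finset.sum_congr rfl fun i _ => by ring
        _ ≤ _ := by gcongr

lemma abs_sum_Ioc_le_of_dyadic {F : ℕ → ℝ} {B₀ B Y : ℝ} (hB : 0 ≤ B) (hF : |F 1| ≤ B₀)
    (hdy : ∀ X : ℝ, 1 ≤ X → 2 * X ≤ Y → |∑ n ∈ Finset.Ioc ⌊X⌋₊ ⌊2 * X⌋₊, F n| ≤ B) (k : ℕ) :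
    ∀ Z : ℝ, Z ≤ Y → Z ≤ 2 ^ k → |∑ n ∈ Finset.Ioc 0 ⌊Z⌋₊, F n| ≤ B₀ + k * B := by
  have hB₀ : 0 ≤ B₀ := (abs_nonneg _).trans hF
  have small : ∀ Z : ℝ, Z < 2 → |∑ n ∈ Finset.Ioc 0 ⌊Z⌋₊, F n| ≤ B₀ := by
    intro Z hZ
    have h1 : ⌊Z⌋₊ < 2 := (Nat.floor_lt' two_ne_zero).2 (by exact_mod_cast hZ)
    interval_cases ⌊Z⌋₊
    · simpa using hB₀
    · simpa using hF
  induction k with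
  | zero =>
    intro Z _ hZ
    simpa using small Z (by rw [pow_zero] at hZ; linarith)
  | succ k ih =>
    intro Z hZY hZ
    rcases lt_or_ge Z 2 with h2 | h2
    · have : 0 ≤ ((k + 1 : ℕ) : ℝ) * B := by positivity
      linarith [small Z h2]
    · have h1 := ih (Z / 2) (by linarith) (by rw [pow_succ] at hZ; linarith)
      have h3 := hdy (Z / 2) (by linarith) (by linarith)
      rw [show 2 * (Z / 2) = Z by ring] at h3
      rw [← Finset.sum_Ioc_consecutive F (Nat.zero_le _)
        (Nat.floor_mono (by linarith : Z / 2 ≤ Z))]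
      push_cast
      linarith [abs_add_le (∑ n ∈ Finset.Ioc 0 ⌊Z / 2⌋₊, F n) (∑ n ∈ Finset.Ioc ⌊Z / 2⌋₊ ⌊Z⌋₊, F n)]

lemma sum_divisor_sum_mul {f g : ℕ → ℝ} (hfg : ∀ n : ℕ, 0 < n → f n = ∑ d ∈ n.divisors, g d)
    (G : ℕ → ℝ) (N : ℕ) :
    ∑ d ∈ Finset.Ioc 0 N, f d * G d =
      ∑ m ∈ Finset.Ioc 0 N, g m * ∑ n ∈ Finset.Ioc 0 (N / m), G (m * n) := by
  have h1 : ∀ d ∈ Finset.Ioc 0 N, f d * G d = ∑ m ∈ d.divisors, g m * G d := by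
    intro d hd
    rw [hfg d (Finset.mem_Ioc.1 hd).1, Finset.sum_mul]
  rw [Finset.sum_congr rfl h1]
  simp only [Finset.mul_sum]
  rw [Finset.sum_sigma', Finset.sum_sigma']
  refine Finset.sum_bij' (fun p _ => ⟨p.2, p.1 / p.2⟩) (fun p _ => ⟨p.1 * p.2, p.1⟩) ?_ ?_ ?_ ?_ ?_
  · rintro ⟨d, m⟩ h
    simp only [Finset.mem_sigma, Finset.mem_Ioc, Nat.mem_divisors] at h ⊢
    have hm := Nat.pos_of_dvd_of_pos h.2.1 h.1.1
    exact ⟨⟨hm, (Nat.le_of_dvd h.1.1 h.2.1).trans h.1.2⟩,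
      Nat.div_pos (Nat.le_of_dvd h.1.1 h.2.1) hm, Nat.div_le_div_right h.1.2⟩
  · rintro ⟨m, n⟩ h
    simp only [Finset.mem_sigma, Finset.mem_Ioc, Nat.mem_divisors] at h ⊢
    have hpos : 0 < m * n := Nat.mul_pos h.1.1 h.2.1
    refine ⟨⟨hpos, ?_⟩, dvd_mul_right _ _, hpos.ne'⟩
    rw [mul_comm]
    exact (Nat.le_div_iff_mul_le h.1.1).1 h.2.2
  · rintro ⟨d, m⟩ h
    simp only [Finset.mem_sigma, Nat.mem_divisors] at h
    simp [Nat.mul_div_cancel' h.2.1]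
  · rintro ⟨m, n⟩ h
    simp only [Finset.mem_sigma, Finset.mem_Ioc] at h
    simp [Nat.mul_div_cancel_left n h.1.1]
  · rintro ⟨d, m⟩ h
    simp only [Finset.mem_sigma, Nat.mem_divisors] at h
    simp [Nat.mul_div_cancel' h.2.1]

lemma sum_abs_div_rpow_le {g : ℕ → ℝ} {α Cg : ℝ} (hα₀ : 0 ≤ α) (hα₁ : α ≤ 1) (hCg : 0 < Cg)
    (hg : ∀ x : ℝ, 1 ≤ x → ∑ n ∈ Finset.Icc 1 ⌊x⌋₊, |g n| ≤ Cg * x ^ α)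
    {D : ℝ} {k : ℕ} (hk : D ≤ 2 ^ k) :
    ∑ m ∈ Finset.Ioc 0 ⌊D⌋₊, |g m| / (m : ℝ) ^ α ≤ Cg + k * (2 * Cg) := by
  refine (le_abs_self _).trans (abs_sum_Ioc_le_of_dyadic (Y := D) (by positivity) ?_ ?_ k D le_rfl hk)
  · have := hg 1 le_rfl
    simpa using this
  · intro X hX _
    have hX0 : 0 < X := by linarith
    rw [abs_of_nonneg (Finset.sum_nonneg fun i _ => by positivity)]
    calc _ ≤ ∑ m ∈ Finset.Ioc ⌊X⌋₊ ⌊2 * X⌋₊, |g m| / X ^ α := by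
          refine Finset.sum_le_sum fun m hm => ?_
          have := Nat.lt_of_floor_lt (Finset.mem_Ioc.1 hm).1
          gcongr
      _ ≤ ∑ m ∈ Finset.Icc 1 ⌊2 * X⌋₊, |g m| / X ^ α := by
          refine Finset.sum_le_sum_of_subset_of_nonneg ?_ fun i _ _ => by positivity
          intro m hm
          have := Finset.mem_Ioc.1 hm
          exact Finset.mem_Icc.2 ⟨by omega, this.2⟩
      _ ≤ Cg * (2 * X) ^ α / X ^ α := by
          rw [← Finset.sum_div]
          gcongr
          exact hg _ (by linarith)
      _ = 2 ^ α * Cg := by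
          rw [Real.mul_rpow zero_le_two hX0.le]
          field_simp
      _ ≤ 2 * Cg := by
          gcongr
          simpa using Real.rpow_le_rpow_of_exponent_le one_le_two hα₁

lemma abs_sum_divisor_sum_sawtooth_le {κ lam δ A Cg : ℝ} (hκ₀ : 0 < κ) (hκ : κ ≤ 1 / 2)
    (hlam : 1 / 2 ≤ lam) (hlam₁ : lam < 1) (hA0 : 0 ≤ A) (hA : ExpSumHyp δ κ lam A)
    {f g : ℕ → ℝ} (hCg : 0 < Cg)
    (hg : ∀ x : ℝ, 1 ≤ x → ∑ n ∈ Finset.Icc 1 ⌊x⌋₊, |g n| ≤ Cg * x ^ (lam / (1 + κ)))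
    (hfg : ∀ n : ℕ, 0 < n → f n = ∑ d ∈ n.divisors, g d)
    {x D : ℝ} (hx : 1 ≤ x) (hD : 1 ≤ D) {k : ℕ} (hk : D ≤ 2 ^ k) :
    |∑ d ∈ Finset.Ioc 0 ⌊D⌋₊, f d * (Int.fract (x / (d + δ)) - 1 / 2)| ≤
      (Cg + k * (2 * Cg)) * (D ^ (lam / (1 + κ)) + k * ((4 + A * (1 / κ + 2)) *
        (x ^ (κ / (1 + κ)) * D ^ ((lam - κ) / (1 + κ)) + D ^ 2 / x))) := by
  have hx0 : 0 < x := by linarith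
  have hD0 : 0 < D := by linarith
  set K := 4 + A * (1 / κ + 2) with hK
  have hK0 : 0 ≤ K := by positivity
  have hα₀ : 0 ≤ lam / (1 + κ) := by positivity
  have hα₁ : lam / (1 + κ) ≤ 1 := (div_le_one (by positivity)).2 (by linarith)
  have hb : 0 ≤ (lam - κ) / (1 + κ) := div_nonneg (by linarith) (by positivity)
  set Q := D ^ (lam / (1 + κ)) + k * (K *
        (x ^ (κ / (1 + κ)) * D ^ ((lam - κ) / (1 + κ)) + D ^ 2 / x)) with hQ
  have hQ0 : 0 ≤ Q := by positivity
  have inner : ∀ m ∈ Finset.Ioc 0 ⌊D⌋₊, |∑ n ∈ Finset.Ioc 0 (⌊D⌋₊ / m),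
      (Int.fract (x / (((m * n : ℕ) : ℝ) + δ)) - 1 / 2)| ≤ Q / (m : ℝ) ^ (lam / (1 + κ)) := by
    intro m hm
    obtain ⟨hm0, hmD⟩ := Finset.mem_Ioc.1 hm
    have hm1 : (1 : ℝ) ≤ m := by exact_mod_cast hm0
    have hmp : (0 : ℝ) < m := by linarith
    have hmD' : (m : ℝ) ≤ D := (Nat.cast_le.2 hmD).trans (Nat.floor_le hD0.le)
    rw [← Nat.floor_div_natCast]
    simp only [Nat.cast_mul]
    have h1 := abs_sum_Ioc_le_of_dyadic
      (F := fun n : ℕ => Int.fract (x / ((m : ℝ) * n + δ)) - 1 / 2) (B₀ := 1)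
      (B := K * ((x / m) ^ (κ / (1 + κ)) * (D / m) ^ ((lam - κ) / (1 + κ)) + m * (D / m) ^ 2 / x))
      (Y := D / m) (by positivity) ((abs_fract_sub_half_le _).trans (by norm_num)) ?_ k (D / m)
      le_rfl ((div_le_self hD0.le hm1).trans hk)
    · refine h1.trans ?_
      have e1 : (x / m) ^ (κ / (1 + κ)) * (D / m) ^ ((lam - κ) / (1 + κ)) =
          x ^ (κ / (1 + κ)) * D ^ ((lam - κ) / (1 + κ)) / (m : ℝ) ^ (lam / (1 + κ)) := by
        have : lam / (1 + κ) = κ / (1 + κ) + (lam - κ) / (1 + κ) := by ring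
        rw [this, Real.rpow_add hmp, Real.div_rpow hx0.le hmp.le, Real.div_rpow hD0.le hmp.le]
        field_simp
      have e2 : m * (D / m) ^ 2 / x ≤ D ^ 2 / x / (m : ℝ) ^ (lam / (1 + κ)) := by
        have : m * (D / m) ^ 2 / x = D ^ 2 / x / m := by field_simp
        rw [this]
        gcongr
        simpa using Real.rpow_le_rpow_of_exponent_le hm1 hα₁
      have e3 : 1 ≤ D ^ (lam / (1 + κ)) / (m : ℝ) ^ (lam / (1 + κ)) := by
        rw [one_le_div (by positivity)]
        gcongr
      calc _ ≤ D ^ (lam / (1 + κ)) / (m : ℝ) ^ (lam / (1 + κ)) + k * (K *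
            (x ^ (κ / (1 + κ)) * D ^ ((lam - κ) / (1 + κ)) / (m : ℝ) ^ (lam / (1 + κ)) +
              D ^ 2 / x / (m : ℝ) ^ (lam / (1 + κ)))) := by
            rw [e1]; gcongr
        _ = _ := by rw [hQ]; ring
    · intro X hX hXD
      refine (hA.abs_sum_sawtooth_dyadic_le hA0 hκ₀ hκ hx hm0 hX).trans ?_
      have : X ≤ D / m := by linarith
      gcongr
  rw [sum_divisor_sum_mul hfg (fun d : ℕ => Int.fract (x / ((d : ℝ) + δ)) - 1 / 2)]
  calc _ ≤ ∑ m ∈ Finset.Ioc 0 ⌊D⌋₊, |g m| / (m : ℝ) ^ (lam / (1 + κ)) * Q := by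
        refine (Finset.abs_sum_le_sum_abs _ _).trans (Finset.sum_le_sum fun m hm => ?_)
        rw [abs_mul, div_mul_eq_mul_div, mul_div_assoc]
        gcongr
        exact inner m hm
    _ ≤ _ := by
        rw [← Finset.sum_mul]
        gcongr
        exact sum_abs_div_rpow_le hα₀ hα₁ hCg hg hk

lemma sum_Ioc_mul_sub_mem {f φ : ℕ → ℝ} {C : ℝ} (hf : ∀ n, 0 < n → 0 < f n)
    (hC : ∀ n, 0 < n → f n ≤ C) (hφ : ∀ n, 0 < n → φ (n + 1) ≤ φ n) (hφ0 : ∀ n, 0 ≤ φ n)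
    {M N : ℕ} (hMN : M ≤ N) :
    0 ≤ ∑ d ∈ Finset.Ioc M N, f d * (φ d - φ (d + 1)) ∧
      ∑ d ∈ Finset.Ioc M N, f d * (φ d - φ (d + 1)) ≤ C * φ (M + 1) := by
  have hpos : ∀ d ∈ Finset.Ioc M N, 0 < d := fun d hd => by have := Finset.mem_Ioc.1 hd; omega
  refine ⟨Finset.sum_nonneg fun d hd =>
    mul_nonneg (hf d (hpos d hd)).le (sub_nonneg.2 (hφ d (hpos d hd))), ?_⟩
  have hC0 : 0 ≤ C := (hf 1 one_pos).le.trans (hC 1 one_pos)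
  have tel : ∑ d ∈ Finset.Ioc M N, (φ d - φ (d + 1)) = φ (M + 1) - φ (N + 1) := by
    induction N, hMN using Nat.le_induction with
    | base => simp
    | succ n hn ih =>
      rw [Finset.sum_Ioc_succ_top (by omega), ih fun d hd => by
        have := Finset.mem_Ioc.1 hd; omega]
      ring
  calc _ ≤ ∑ d ∈ Finset.Ioc M N, C * (φ d - φ (d + 1)) := by
        refine Finset.sum_le_sum fun d hd => ?_
        have := hφ d (hpos d hd)
        exact mul_le_mul_of_nonneg_right (hC d (hpos d hd)) (by linarith)
    _ = C * (φ (M + 1) - φ (N + 1)) := by rw [← Finset.mul_sum, tel]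
    _ ≤ C * φ (M + 1) := by
        gcongr
        linarith [hφ0 (N + 1)]

lemma abs_tsum_sub_sum_Ioc_le {f : ℕ → ℝ} {C : ℝ} (hf : ∀ n, 0 < n → 0 < f n)
    (hC : ∀ n, 0 < n → f n ≤ C) (M : ℕ) :
    |∑' n : ℕ, f (n + 1) / (((n : ℝ) + 1) * ((n : ℝ) + 2)) -
      ∑ d ∈ Finset.Ioc 0 M, f d * (1 / (d : ℝ) - 1 / ((d + 1 : ℕ) : ℝ))| ≤ C / (M + 1) := by
  have hφ : ∀ n : ℕ, 0 < n → 1 / ((n + 1 : ℕ) : ℝ) ≤ 1 / (n : ℝ) := by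
    intro n hn
    have : (0 : ℝ) < n := by exact_mod_cast hn
    gcongr
    simp
  have key := fun {M N : ℕ} (h : M ≤ N) => sum_Ioc_mul_sub_mem hf hC
    (φ := fun n : ℕ => 1 / (n : ℝ)) hφ (fun n => by positivity) h
  have partial_sum : ∀ N : ℕ, ∑ n ∈ Finset.range N, f (n + 1) / (((n : ℝ) + 1) * ((n : ℝ) + 2)) =
      ∑ d ∈ Finset.Ioc 0 N, f d * (1 / (d : ℝ) - 1 / ((d + 1 : ℕ) : ℝ)) := by
    intro N
    induction N with
    | zero => simp
    | succ N ih =>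
      rw [Finset.sum_range_succ, Finset.sum_Ioc_succ_top (Nat.zero_le _), ih]
      congr 1
      push_cast
      field_simp
      ring
  have hsum : Summable fun n : ℕ => f (n + 1) / (((n : ℝ) + 1) * ((n : ℝ) + 2)) := by
    refine summable_of_sum_range_le (c := C) (fun n => ?_) fun N => ?_
    · have := hf (n + 1) (by omega)
      positivity
    · rw [partial_sum]
      simpa using (key (Nat.zero_le N)).2
  refine le_of_tendsto ((hsum.hasSum.tendsto_sum_nat.sub_const _).abs) ?_
  filter_upwards [eventually_ge_atTop M] with N hN
  rw [partial_sum, ← Finset.sum_Ioc_consecutive _ (Nat.zero_le M) hN, add_sub_cancel_left,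
    abs_of_nonneg (key hN).1]
  refine (key hN).2.trans_eq ?_
  push_cast
  ring

lemma sum_comp_floor_div {x : ℝ} (hx : 0 ≤ x) (f : ℕ → ℝ) :
    ∑ n ∈ Finset.Icc 1 ⌊x⌋₊, f ⌊x / (n : ℝ)⌋₊ =
      ∑ d ∈ Finset.Ioc 0 ⌊x⌋₊,
        f d * ((⌊x / (d : ℝ)⌋₊ : ℝ) - (⌊x / ((d + 1 : ℕ) : ℝ)⌋₊ : ℝ)) := by
  have hmaps : ∀ n ∈ Finset.Icc 1 ⌊x⌋₊, ⌊x / (n : ℝ)⌋₊ ∈ Finset.Ioc 0 ⌊x⌋₊ := by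
    intro n hn
    obtain ⟨h1, h2⟩ := Finset.mem_Icc.1 hn
    have hn1 : (1 : ℝ) ≤ n := by exact_mod_cast h1
    refine Finset.mem_Ioc.2 ⟨Nat.floor_pos.2 ?_, Nat.floor_mono (div_le_self hx hn1)⟩
    rw [one_le_div (by linarith)]
    exact (Nat.cast_le.2 h2).trans (Nat.floor_le hx)
  rw [← Finset.sum_fiberwise_of_maps_to hmaps]
  refine Finset.sum_congr rfl fun d hd => ?_
  have hd0 := (Finset.mem_Ioc.1 hd).1
  have hdp : (0 : ℝ) < d := by exact_mod_cast hd0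
  have hfib : (Finset.Icc 1 ⌊x⌋₊).filter (fun n : ℕ => ⌊x / (n : ℝ)⌋₊ = d) =
      Finset.Ioc ⌊x / ((d + 1 : ℕ) : ℝ)⌋₊ ⌊x / (d : ℝ)⌋₊ := by
    ext n
    rw [Finset.mem_filter, Finset.mem_Icc, Finset.mem_Ioc]
    rcases Nat.eq_zero_or_pos n with rfl | hn
    · simp
    have hnp : (0 : ℝ) < n := by exact_mod_cast hn
    rw [Nat.floor_lt (by positivity), Nat.le_floor_iff (by positivity),
      Nat.floor_eq_iff (by positivity), Nat.le_floor_iff (by positivity), le_div_iff₀ hnp, div_lt_iff₀ hnp,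
      div_lt_iff₀ (by positivity), le_div_iff₀ hdp, mul_comm (d : ℝ)]
    push_cast
    rw [mul_comm (n : ℝ) (d + 1)]
    refine ⟨fun h => ⟨h.2.2, h.2.1⟩, fun h => ⟨⟨hn, ?_⟩, h.2, h.1⟩⟩
    have : (1 : ℝ) ≤ d := by exact_mod_cast hd0
    nlinarith
  rw [Finset.sum_congr rfl (g := fun _ => f d)
    (fun n hn => by rw [(Finset.mem_filter.1 hn).2]), hfib, Finset.sum_const, Nat.card_Ioc,
    nsmul_eq_mul, Nat.cast_sub, mul_comm]
  refine Nat.floor_mono ?_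
  gcongr
  simp

/-- Approximation of `S_f(x)` in terms of two sawtooth sums of length `M`. -/
lemma abs_sum_comp_floor_sub_le {f : ℕ → ℝ} {C : ℝ} (hf : ∀ n, 0 < n → 0 < f n)
    (hC : ∀ n, 0 < n → f n ≤ C) {x : ℝ} (hx : 0 ≤ x) {M : ℕ} (hM : M ≤ ⌊x⌋₊) :
    |∑ n ∈ Finset.Icc 1 ⌊x⌋₊, f ⌊x / (n : ℝ)⌋₊ -
        (∑' n : ℕ, f (n + 1) / (((n : ℝ) + 1) * ((n : ℝ) + 2))) * x| ≤
      2 * C * (x / (M + 1)) +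
        |∑ d ∈ Finset.Ioc 0 M, f d * (Int.fract (x / ((d : ℝ) + 0)) - 1 / 2)| +
        |∑ d ∈ Finset.Ioc 0 M, f d * (Int.fract (x / ((d : ℝ) + 1)) - 1 / 2)| := by
  have hC0 : 0 ≤ C := (hf 1 one_pos).le.trans (hC 1 one_pos)
  have htail := sum_Ioc_mul_sub_mem hf hC (φ := fun d : ℕ => (⌊x / (d : ℝ)⌋₊ : ℝ))
    (fun n hn => by
      have : (0 : ℝ) < n := by exact_mod_cast hn
      refine Nat.cast_le.2 (Nat.floor_mono ?_)
      gcongr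
      simp) (fun n => Nat.cast_nonneg _) hM
  have hts := abs_tsum_sub_sum_Ioc_le hf hC M
  rw [sum_comp_floor_div hx, ← Finset.sum_Ioc_consecutive _ (Nat.zero_le M) hM]
  have hfl : ∀ y : ℝ, 0 ≤ y → (⌊y⌋₊ : ℝ) = y - Int.fract y := by
    intro y hy
    rw [← Int.self_sub_floor, natCast_floor_eq_intCast_floor hy]
    ring
  have hhead : ∑ d ∈ Finset.Ioc 0 M,
      f d * ((⌊x / (d : ℝ)⌋₊ : ℝ) - (⌊x / ((d + 1 : ℕ) : ℝ)⌋₊ : ℝ)) =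
      x * ∑ d ∈ Finset.Ioc 0 M, f d * (1 / (d : ℝ) - 1 / ((d + 1 : ℕ) : ℝ)) -
      ∑ d ∈ Finset.Ioc 0 M, f d * (Int.fract (x / ((d : ℝ) + 0)) - 1 / 2) +
      ∑ d ∈ Finset.Ioc 0 M, f d * (Int.fract (x / ((d : ℝ) + 1)) - 1 / 2) := by
    rw [Finset.mul_sum, ← Finset.sum_sub_distrib, ← Finset.sum_add_distrib]
    refine Finset.sum_congr rfl fun d _ => ?_
    rw [hfl _ (by positivity), hfl _ (by positivity), add_zero]
    push_cast
    ring
  have htail' : C * (⌊x / ((M + 1 : ℕ) : ℝ)⌋₊ : ℝ) ≤ C * (x / (M + 1)) := by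
    gcongr
    refine (Nat.floor_le (by positivity)).trans_eq ?_
    push_cast
    rfl
  rw [hhead]
  set T := ∑' n : ℕ, f (n + 1) / (((n : ℝ) + 1) * ((n : ℝ) + 2))
  set P := ∑ d ∈ Finset.Ioc 0 M, f d * (1 / (d : ℝ) - 1 / ((d + 1 : ℕ) : ℝ))
  set S0 := ∑ d ∈ Finset.Ioc 0 M, f d * (Int.fract (x / ((d : ℝ) + 0)) - 1 / 2)
  set S1 := ∑ d ∈ Finset.Ioc 0 M, f d * (Int.fract (x / ((d : ℝ) + 1)) - 1 / 2)
  have hPT : |x * (T - P)| ≤ C * (x / (M + 1)) := by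
    rw [abs_mul, abs_of_nonneg hx]
    calc x * |T - P| ≤ x * (C / (M + 1)) := by gcongr
      _ = _ := by ring
  have a1 := abs_le.1 hPT
  have a2 := le_abs_self S0
  have a3 := neg_abs_le S0
  have a4 := le_abs_self S1
  have a5 := neg_abs_le S1
  have a6 := htail.2.trans htail'
  rw [abs_le]
  constructor <;> linarith [htail.1, a1.1, a1.2]

/-- If `(κ,λ)` satisfies the exponential-sum hypothesis for `δ = 0` and
`δ = 1`, `∑_{n ≤ x} |g(n)| = O(x^{λ/(1+κ)})`, and `f(n) = ∑_{d∣n} g(d)` is a positive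
real-valued arithmetic function with `f(n) = O(1)`, then
`S_f(x) = ∑_{n ≤ x} f(⌊x/n⌋) = C_f x + O(x^{λ/(1+λ)} (log x)²)` as `x → ∞`, where
`C_f = ∑_{n=1}^∞ f(n)/(n(n+1))`. -/
theorem S_f_asymptotic_bounded (κ lam : ℝ)
    (hκ₀ : 0 < κ) (hκ : κ ≤ 1 / 2) (hlam : 1 / 2 ≤ lam) (hlam₁ : lam < 1)
    (A₀ : ℝ) (hA₀ : ExpSumHyp 0 κ lam A₀)
    (A₁ : ℝ) (hA₁ : ExpSumHyp 1 κ lam A₁)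
    (g : ℕ → ℝ)
    (hg : ∃ Cg : ℝ, 0 < Cg ∧ ∀ x : ℝ, 1 ≤ x →
      ∑ n ∈ Finset.Icc 1 ⌊x⌋₊, |g n| ≤ Cg * x ^ (lam / (1 + κ)))
    (f : ℕ → ℝ)
    (hfg : ∀ n : ℕ, 0 < n → f n = ∑ d ∈ n.divisors, g d)
    (hfpos : ∀ n : ℕ, 0 < n → 0 < f n)
    (hfbd : ∃ Cf : ℝ, 0 < Cf ∧ ∀ n : ℕ, 0 < n → f n ≤ Cf) :
    (fun x : ℝ => (∑ n ∈ Finset.Icc 1 ⌊x⌋₊, f ⌊x / (n : ℝ)⌋₊) -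
        (∑' n : ℕ, f (n + 1) / (((n : ℝ) + 1) * ((n : ℝ) + 2))) * x)
      =O[atTop] fun x : ℝ => x ^ (lam / (1 + lam)) * (Real.log x) ^ 2 := by
  obtain ⟨Cg, hCg, hg⟩ := hg
  obtain ⟨Cf, hCf, hfbd⟩ := hfbd
  obtain ⟨A, hA0, hA₀', hA₁'⟩ : ∃ A : ℝ, 0 ≤ A ∧ ExpSumHyp 0 κ lam A ∧ ExpSumHyp 1 κ lam A :=
    ⟨max (max A₀ A₁) 0, le_max_right _ _, hA₀.mono ((le_max_left _ _).trans (le_max_left _ _)),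
      hA₁.mono ((le_max_right _ _).trans (le_max_left _ _))⟩
  set K := 4 + A * (1 / κ + 2) with hK
  have hK0 : 0 ≤ K := by positivity
  refine IsBigO.of_bound (2 * Cf + 2 * (7 * Cg * (1 + 6 * K))) ?_
  filter_upwards [eventually_ge_atTop (Real.exp 1)] with x hxe
  have hx0 : 0 < x := (Real.exp_pos 1).trans_le hxe
  have hL : 1 ≤ Real.log x := (Real.le_log_iff_exp_le hx0).2 hxe
  have hx : 1 ≤ x := (Real.one_le_exp zero_le_one).trans hxe
  set L := Real.log x with hLdef
  set D := x ^ (1 / (1 + lam)) with hDdef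
  set R := x ^ (lam / (1 + lam)) with hRdef
  have hR0 : 0 < R := by positivity
  have hlam0 : 0 < lam := by linarith
  have hD : 1 ≤ D := Real.one_le_rpow hx (by positivity)
  have hDx : D ≤ x := by
    rw [hDdef]
    refine (Real.rpow_le_rpow_of_exponent_le hx ?_).trans_eq (Real.rpow_one x)
    exact (div_le_one (by positivity)).2 (by linarith)
  set k := ⌈2 * L⌉₊ with hkdef
  have hkL : (k : ℝ) ≤ 3 * L := by
    have := Nat.ceil_lt_add_one (by positivity : 0 ≤ 2 * L)
    linarith
  have hk : D ≤ 2 ^ k := by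
    refine hDx.trans ?_
    rw [← Real.rpow_natCast, ← Real.log_le_log_iff hx0 (by positivity),
      Real.log_rpow two_pos]
    have h1 := Nat.le_ceil (2 * L)
    have h2 := Real.log_two_gt_d9
    nlinarith
  have r1 : D ^ (lam / (1 + κ)) ≤ R := by
    rw [hDdef, ← Real.rpow_mul hx0.le]
    refine Real.rpow_le_rpow_of_exponent_le hx ?_
    rw [div_mul_div_comm, one_mul]
    gcongr
    nlinarith
  have r2 : x ^ (κ / (1 + κ)) * D ^ ((lam - κ) / (1 + κ)) = R := by
    rw [hDdef, ← Real.rpow_mul hx0.le, ← Real.rpow_add hx0, hRdef]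
    congr 1
    field_simp
    ring
  have r3 : D ^ 2 / x ≤ R := by
    rw [hDdef, ← Real.rpow_natCast, ← Real.rpow_mul hx0.le, ← Real.rpow_sub_one hx0.ne', hRdef]
    refine Real.rpow_le_rpow_of_exponent_le hx ?_
    rw [div_mul_eq_mul_div, one_mul, div_sub_one (by positivity)]
    gcongr
    push_cast
    linarith
  have r4 : x / (⌊D⌋₊ + 1) ≤ R := by
    have h1 : x / D = R := by
      rw [hDdef, ← Real.rpow_one_sub' hx0.le, hRdef]
      · congr 1
        field_simp
        ring
      · rw [one_sub_div (by positivity)]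
        simp only [add_sub_cancel_left]
        positivity
    rw [← h1]
    gcongr
    exact (Nat.lt_floor_add_one D).le
  have saw : ∀ δ : ℝ, ExpSumHyp δ κ lam A →
      |∑ d ∈ Finset.Ioc 0 ⌊D⌋₊, f d * (Int.fract (x / (d + δ)) - 1 / 2)| ≤
        7 * Cg * (1 + 6 * K) * (R * L ^ 2) := by
    intro δ hδ
    refine (abs_sum_divisor_sum_sawtooth_le hκ₀ hκ hlam hlam₁ hA0 hδ hCg hg hfg hx hD hk).trans ?_
    rw [r2]
    calc _ ≤ (Cg * L + 3 * L * (2 * Cg)) * (R * L + 3 * L * (K * (R + R))) := by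
          gcongr
          · exact le_mul_of_one_le_right hCg.le hL
          · exact r1.trans (le_mul_of_one_le_right hR0.le hL)
      _ = _ := by ring
  have hfin := abs_sum_comp_floor_sub_le hfpos hfbd hx0.le (Nat.floor_mono hDx)
  have s0 := saw 0 hA₀'
  have s1 := saw 1 hA₁'
  rw [Real.norm_eq_abs, Real.norm_eq_abs, abs_of_nonneg (by positivity : 0 ≤ R * L ^ 2)]
  have hRL : x / (⌊D⌋₊ + 1) ≤ R * L ^ 2 :=
    r4.trans (le_mul_of_one_le_right hR0.le (one_le_pow₀ hL))
  have h2 : 2 * Cf * (x / (⌊D⌋₊ + 1)) ≤ 2 * Cf * (R * L ^ 2) := by gcongr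
  linarith
end
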